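/- Fix y>0 and D≥0, and suppose 0 ≤ H_l ≤ D^l for every l∈ℕ. Define for k∈ℕ the numbers m_k := Σ_{s=1}^{k} y^{k−s} · (k!/s!) · Σ_{(i_1,…,i_s): i_1+…+i_s=k−s+1, i_1+2i_2+…+s·i_s=k} ∏_{l=1}^{s} H_l^{i_l}/i_l!. Then the sequence (m_k) satisfies the Carleman condition Σ_{k=1}^∞ m_{2k}^{−1/(2k)} = ∞; consequently there is at most one probability measure on ℝ with k-th moment m_k for all k. -/

import Mathlib

open MeasureTheory

/-- The candidate `k`-th moment
`Σ_{s=1}^{k} y^{k-s} (k!/s!) Σ_{i_1+⋯+i_s = k-s+1, i_1+2i_2+⋯+s·i_s = k} ∏_{l=1}^{s} H_l^{i_l}/i_l!`,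
the inner sum ranging over tuples of non-negative integers `(i_1,…,i_s)` (every such tuple
automatically has all entries `≤ k`). -/
noncomputable def momentFormula (y : ℝ) (H : ℕ → ℝ) (k : ℕ) : ℝ :=
  ∑ s ∈ Finset.Icc 1 k, y ^ (k - s) * ((Nat.factorial k : ℝ) / (Nat.factorial s : ℝ)) *
    ∑ f ∈ Fintype.piFinset (fun _ : Fin s => Finset.range (k + 1)),
      if (∑ l, f l) = k - s + 1 ∧ (∑ l : Fin s, (l.val + 1) * f l) = k then
        ∏ l : Fin s, H (l.val + 1) ^ f l / (Nat.factorial (f l) : ℝ)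
      else 0

open Filter Topology ProbabilityTheory

/-- The sum of products of inverse factorials over tuples is at most exponential. -/
lemma sum_piFinset_prod_inv_factorial_le (s n : ℕ) :
    ∑ f ∈ Fintype.piFinset (fun _ : Fin s => Finset.range n),
      ∏ l : Fin s, (1 : ℝ) / (Nat.factorial (f l) : ℝ) ≤ 3 ^ s := by
  rw [← Finset.prod_univ_sum (fun _ : Fin s => Finset.range n)
    (fun _ i => (1 : ℝ) / (Nat.factorial i : ℝ))]
  have h : ∑ i ∈ Finset.range n, (1 : ℝ) / (Nat.factorial i : ℝ) ≤ 3 := by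
    have := Real.sum_le_exp_of_nonneg zero_le_one n
    simp only [one_pow] at this
    exact this.trans Real.exp_one_lt_three.le
  calc ∏ _l : Fin s, ∑ i ∈ Finset.range n, (1 : ℝ) / (Nat.factorial i : ℝ)
      ≤ ∏ _l : Fin s, (3 : ℝ) :=
        Finset.prod_le_prod (fun _ _ => Finset.sum_nonneg fun _ _ => by positivity) fun _ _ => h
    _ = 3 ^ s := by simp

lemma prod_pow_div_factorial_le {D : ℝ} {H : ℕ → ℝ} (hH0 : ∀ l : ℕ, 1 ≤ l → 0 ≤ H l)
    (hHD : ∀ l : ℕ, 1 ≤ l → H l ≤ D ^ l) {s : ℕ} (f : Fin s → ℕ) :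
    ∏ l : Fin s, H (l.val + 1) ^ f l / (Nat.factorial (f l) : ℝ) ≤
      D ^ (∑ l : Fin s, (l.val + 1) * f l) *
        ∏ l : Fin s, (1 : ℝ) / (Nat.factorial (f l) : ℝ) := by
  rw [← Finset.prod_pow_eq_pow_sum, ← Finset.prod_mul_distrib]
  refine Finset.prod_le_prod (fun l _ => ?_) fun l _ => ?_
  · have := hH0 (l.val + 1) (by omega)
    positivity
  · rw [mul_one_div, pow_mul]
    gcongr
    · exact hH0 _ (by omega)
    · exact hHD _ (by omega)

lemma exists_momentFormula_le {y D : ℝ} (hy : 0 < y) (hD : 0 ≤ D)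
    {H : ℕ → ℝ} (hH0 : ∀ l : ℕ, 1 ≤ l → 0 ≤ H l) (hHD : ∀ l : ℕ, 1 ≤ l → H l ≤ D ^ l) :
    ∃ C : ℝ, 0 < C ∧ ∀ k : ℕ, momentFormula y H k ≤ C ^ k * (Nat.factorial k : ℝ) := by
  have hY : 1 ≤ max 1 y := le_max_left _ _
  have hE : 1 ≤ max 1 D := le_max_left _ _
  refine ⟨2 * (max 1 y * (max 1 D * 3)), by positivity, fun k => ?_⟩
  have hterm : ∀ s ∈ Finset.Icc 1 k,
      y ^ (k - s) * ((Nat.factorial k : ℝ) / (Nat.factorial s : ℝ)) *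
      (∑ f ∈ Fintype.piFinset (fun _ : Fin s => Finset.range (k + 1)),
        if (∑ l, f l) = k - s + 1 ∧ (∑ l : Fin s, (l.val + 1) * f l) = k then
          ∏ l : Fin s, H (l.val + 1) ^ f l / (Nat.factorial (f l) : ℝ)
        else 0) ≤ max 1 y ^ k * (Nat.factorial k : ℝ) * (max 1 D ^ k * 3 ^ k) := by
    intro s hs
    obtain ⟨hs1, hsk⟩ := Finset.mem_Icc.1 hs
    have h1 : y ^ (k - s) ≤ max 1 y ^ k :=
      (pow_le_pow_left₀ hy.le (le_max_right _ _) _).trans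
        (pow_le_pow_right₀ hY (Nat.sub_le _ _))
    have h2 : (Nat.factorial k : ℝ) / (Nat.factorial s : ℝ) ≤ Nat.factorial k :=
      div_le_self (by positivity) (by exact_mod_cast Nat.factorial_pos s)
    have h3 : (∑ f ∈ Fintype.piFinset (fun _ : Fin s => Finset.range (k + 1)),
        if (∑ l, f l) = k - s + 1 ∧ (∑ l : Fin s, (l.val + 1) * f l) = k then
          ∏ l : Fin s, H (l.val + 1) ^ f l / (Nat.factorial (f l) : ℝ)
        else 0) ≤ max 1 D ^ k * 3 ^ k := by
      calc _ ≤ ∑ f ∈ Fintype.piFinset (fun _ : Fin s => Finset.range (k + 1)),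
            max 1 D ^ k * ∏ l : Fin s, (1 : ℝ) / (Nat.factorial (f l) : ℝ) := by
            refine Finset.sum_le_sum fun f _ => ?_
            split_ifs with hf
            · refine (prod_pow_div_factorial_le hH0 hHD f).trans ?_
              rw [hf.2]
              gcongr
              exact le_max_right _ _
            · positivity
        _ ≤ max 1 D ^ k * 3 ^ s := by
            rw [← Finset.mul_sum]
            gcongr
            exact sum_piFinset_prod_inv_factorial_le _ _
        _ ≤ max 1 D ^ k * 3 ^ k := by
            gcongr
            norm_num
    refine mul_le_mul (mul_le_mul h1 h2 (by positivity) (by positivity)) h3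
      (Finset.sum_nonneg fun f _ => ?_) (by positivity)
    split_ifs
    · exact Finset.prod_nonneg fun l _ =>
        div_nonneg (pow_nonneg (hH0 _ (by omega)) _) (by positivity)
    · exact le_rfl
  have hk : (k : ℝ) ≤ 2 ^ k := by exact_mod_cast Nat.lt_two_pow_self.le
  calc momentFormula y H k
      ≤ ∑ _s ∈ Finset.Icc 1 k,
          max 1 y ^ k * (Nat.factorial k : ℝ) * (max 1 D ^ k * 3 ^ k) :=
        Finset.sum_le_sum hterm
    _ = k * (max 1 y ^ k * (Nat.factorial k : ℝ) * (max 1 D ^ k * 3 ^ k)) := by simp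
    _ ≤ 2 ^ k * (max 1 y ^ k * (Nat.factorial k : ℝ) * (max 1 D ^ k * 3 ^ k)) := by gcongr
    _ = _ := by simp only [mul_pow]; ring

/-- Factorial growth of the even moments implies Carleman's condition. -/
lemma tsum_inv_rpow_eq_top_of_le_pow_mul_factorial {m : ℕ → ℝ} {C : ℝ} (hC : 0 < C)
    (hm : ∀ k : ℕ, 1 ≤ k → m k ≤ C ^ k * (Nat.factorial k : ℝ)) :
    ∑' j : ℕ, (ENNReal.ofReal (m (2 * (j + 1))))⁻¹ ^ ((1 : ℝ) / (2 * (j + 1))) = ⊤ := by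
  have hle : ∀ j : ℕ, ENNReal.ofReal ((2 * C)⁻¹ * (1 / ((j : ℝ) + 1))) ≤
      (ENNReal.ofReal (m (2 * (j + 1))))⁻¹ ^ ((1 : ℝ) / (2 * (j + 1))) := by
    intro j
    set n : ℕ := 2 * (j + 1) with hn
    have hn0 : (0 : ℝ) < n := by positivity
    have hnc : (2 * ((j : ℝ) + 1)) = n := by rw [hn]; push_cast; ring
    have h1 : m n ≤ (C * n) ^ n := by
      refine (hm n (by omega)).trans ?_
      rw [mul_pow]
      gcongr
      exact_mod_cast Nat.factorial_le_pow n
    have h2 : ENNReal.ofReal (m n) ≤ ENNReal.ofReal (C * n) ^ n := by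
      rw [← ENNReal.ofReal_pow (by positivity)]
      exact ENNReal.ofReal_le_ofReal h1
    calc ENNReal.ofReal ((2 * C)⁻¹ * (1 / ((j : ℝ) + 1)))
        = (ENNReal.ofReal (C * n))⁻¹ := by
          rw [← ENNReal.ofReal_inv_of_pos (by positivity), ← hnc]
          congr 1
          field_simp
      _ = ((ENNReal.ofReal (C * n) ^ n)⁻¹) ^ ((1 : ℝ) / n) := by
          rw [ENNReal.inv_rpow, ← ENNReal.rpow_natCast, ← ENNReal.rpow_mul,
            mul_one_div_cancel hn0.ne', ENNReal.rpow_one]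
      _ ≤ (ENNReal.ofReal (m n))⁻¹ ^ ((1 : ℝ) / n) :=
          ENNReal.rpow_le_rpow (ENNReal.inv_le_inv.2 h2) (by positivity)
      _ = _ := by rw [hnc]
  refine top_unique (le_trans (top_le_iff.2 ?_) (ENNReal.tsum_le_tsum hle))
  by_contra hne
  have hs := ENNReal.summable_toReal hne
  have hs' : Summable fun j : ℕ => (2 * C)⁻¹ * (1 / ((j : ℝ) + 1)) := by
    refine hs.congr fun j => ENNReal.toReal_ofReal (by positivity)
  rw [summable_mul_left_iff (by positivity)] at hs'
  refine Real.not_summable_one_div_natCast ((summable_nat_add_iff 1).1 ?_)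
  simpa using hs'

/-- A probability measure whose moments grow at most like `C ^ k * k!` has exponential moments. -/
lemma integrable_exp_mul_of_moment_le {ν : Measure ℝ} [IsProbabilityMeasure ν] {C : ℝ} (hC : 0 < C)
    (hint : ∀ k : ℕ, 1 ≤ k → Integrable (fun x : ℝ => x ^ k) ν)
    (hle : ∀ k : ℕ, 1 ≤ k → ∫ x, x ^ k ∂ν ≤ C ^ k * (Nat.factorial k : ℝ))
    {t : ℝ} (ht : |t| < C⁻¹) : Integrable (fun x : ℝ => Real.exp (t * x)) ν := by
  have hint' : ∀ k : ℕ, Integrable (fun x : ℝ => x ^ k) ν := fun k => by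
    rcases Nat.eq_zero_or_pos k with rfl | hk
    · simp
    · exact hint k hk
  have hle' : ∀ k : ℕ, ∫ x, x ^ k ∂ν ≤ C ^ k * (Nat.factorial k : ℝ) := fun k => by
    rcases Nat.eq_zero_or_pos k with rfl | hk
    · simp
    · exact hle k hk
  have hfi : ∀ n : ℕ, Integrable (fun x : ℝ => (t * x) ^ (2 * n) / (Nat.factorial (2 * n) : ℝ)) ν :=
    fun n => by
      simp only [mul_pow]
      exact ((hint' (2 * n)).const_mul _).div_const _
  have hf0 : ∀ (n : ℕ) (x : ℝ), 0 ≤ (t * x) ^ (2 * n) / (Nat.factorial (2 * n) : ℝ) := fun n x =>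
    div_nonneg ((even_two_mul n).pow_nonneg _) (by positivity)
  have hfb : ∀ n : ℕ, ∫ x, (t * x) ^ (2 * n) / (Nat.factorial (2 * n) : ℝ) ∂ν
      ≤ ((t * C) ^ 2) ^ n := fun n => by
    simp only [mul_pow t _ (2 * n)]
    rw [integral_div, integral_const_mul, div_le_iff₀ (by positivity), ← pow_mul, mul_pow,
      mul_assoc]
    exact mul_le_mul_of_nonneg_left (hle' _) ((even_two_mul n).pow_nonneg _)
  have hr : (t * C) ^ 2 < 1 := by
    rw [sq_lt_one_iff_abs_lt_one, abs_mul, abs_of_pos hC]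
    calc |t| * C < C⁻¹ * C := by gcongr
      _ = 1 := inv_mul_cancel₀ hC.ne'
  have hcosh : Integrable (fun x : ℝ => Real.cosh (t * x)) ν := by
    refine ⟨by fun_prop, ?_⟩
    rw [hasFiniteIntegral_iff_ofReal (ae_of_all _ fun x => (Real.cosh_pos _).le)]
    have hx : ∀ x : ℝ, ENNReal.ofReal (Real.cosh (t * x)) =
        ∑' n : ℕ, ENNReal.ofReal ((t * x) ^ (2 * n) / (Nat.factorial (2 * n) : ℝ)) := fun x => by
      rw [← (Real.hasSum_cosh (t * x)).tsum_eq,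
        ENNReal.ofReal_tsum_of_nonneg (fun n => hf0 n x) (Real.hasSum_cosh (t * x)).summable]
    simp only [hx]
    rw [lintegral_tsum fun n => by fun_prop]
    calc ∑' n : ℕ, ∫⁻ x, ENNReal.ofReal ((t * x) ^ (2 * n) / (Nat.factorial (2 * n) : ℝ)) ∂ν
        ≤ ∑' n : ℕ, ENNReal.ofReal (((t * C) ^ 2) ^ n) := by
          refine ENNReal.tsum_le_tsum fun n => ?_
          rw [← ofReal_integral_eq_lintegral_ofReal (hfi n) (ae_of_all _ (hf0 n))]
          exact ENNReal.ofReal_le_ofReal (hfb n)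
      _ < ⊤ := (summable_geometric_of_lt_one (sq_nonneg _) hr).tsum_ofReal_ne_top.lt_top
  refine (hcosh.const_mul 2).mono' (by fun_prop) (ae_of_all _ fun x => ?_)
  rw [Real.norm_eq_abs, abs_of_pos (Real.exp_pos _), Real.cosh_eq]
  have := Real.exp_pos (-(t * x))
  linarith

lemma zero_mem_interior_integrableExpSet_of_moment_le {ν : Measure ℝ} [IsProbabilityMeasure ν]
    {C : ℝ} (hC : 0 < C)
    (hint : ∀ k : ℕ, 1 ≤ k → Integrable (fun x : ℝ => x ^ k) ν)
    (hle : ∀ k : ℕ, 1 ≤ k → ∫ x, x ^ k ∂ν ≤ C ^ k * (Nat.factorial k : ℝ)) :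
    0 ∈ interior (integrableExpSet id ν) := by
  rw [mem_interior_iff_mem_nhds, Metric.mem_nhds_iff]
  refine ⟨C⁻¹, by positivity, fun t ht => ?_⟩
  rw [mem_ball_zero_iff, Real.norm_eq_abs] at ht
  exact integrable_exp_mul_of_moment_le hC hint hle ht

/-- Two probability measures with exponential moments near `0` and equal moments are equal. -/
lemma eq_of_moment_eq_of_zero_mem_interior_integrableExpSet {ν₁ ν₂ : Measure ℝ}
    [IsProbabilityMeasure ν₁] [IsProbabilityMeasure ν₂]
    (h₁ : 0 ∈ interior (integrableExpSet id ν₁)) (h₂ : 0 ∈ interior (integrableExpSet id ν₂))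
    (hm : ∀ k : ℕ, 1 ≤ k → ∫ x, x ^ k ∂ν₁ = ∫ x, x ^ k ∂ν₂) : ν₁ = ν₂ := by
  set S : Set ℝ := interior (integrableExpSet id ν₁) ∩ interior (integrableExpSet id ν₂)
  have hSc : Convex ℝ S := convex_integrableExpSet.interior.inter convex_integrableExpSet.interior
  have ha₁ : AnalyticOnNhd ℂ (complexMGF id ν₁) (Complex.re ⁻¹' S) :=
    fun z hz => analyticAt_complexMGF hz.1
  have ha₂ : AnalyticOnNhd ℂ (complexMGF id ν₂) (Complex.re ⁻¹' S) :=
    fun z hz => analyticAt_complexMGF hz.2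
  have h0 : (0 : ℂ) ∈ Complex.re ⁻¹' S := ⟨by simpa using h₁, by simpa using h₂⟩
  have hd : ∀ n : ℕ,
      iteratedDeriv n (complexMGF id ν₁) 0 = iteratedDeriv n (complexMGF id ν₂) 0 := fun n => by
    rw [iteratedDeriv_complexMGF h0.1, iteratedDeriv_complexMGF h0.2]
    rcases Nat.eq_zero_or_pos n with rfl | hn
    · simp
    · simpa [← Complex.ofReal_pow, integral_complex_ofReal] using hm n hn
  have hev : complexMGF id ν₁ =ᶠ[𝓝 0] complexMGF id ν₂ := by
    have e₁ := (ha₁ 0 h0).hasFPowerSeriesAt.eventually_hasSum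
    have e₂ := (ha₂ 0 h0).hasFPowerSeriesAt.eventually_hasSum
    simp only [hd] at e₁
    filter_upwards [e₁, e₂] with z hz₁ hz₂
    simpa using hz₁.unique hz₂
  have heq : Set.EqOn (complexMGF id ν₁) (complexMGF id ν₂) (Complex.re ⁻¹' S) :=
    ha₁.eqOn_of_preconnected_of_eventuallyEq ha₂
      (hSc.linear_preimage Complex.reLm).isPreconnected h0 hev
  refine Measure.ext_of_charFun (funext fun t => ?_)
  rw [← complexMGF_id_mul_I, ← complexMGF_id_mul_I]
  exact heq ⟨by simpa using h₁, by simpa using h₂⟩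

/-- **Carleman's condition for the limiting moments.** Fix `y > 0` and `D ≥ 0` and suppose
`0 ≤ H_l ≤ D^l` for every `l ≥ 1`. Let `m_k` be given by the moment formula of the main
theorem. Then `Σ_{k≥1} m_{2k}^{-1/(2k)} = ∞` (computed in `ℝ≥0∞`, so that `m_{2k} = 0`
contributes `∞`); consequently, there is at most one probability measure on `ℝ` having
`m_k` as its `k`-th moment for every `k ≥ 1`. -/
theorem carleman_condition_momentFormula (y D : ℝ) (hy : 0 < y) (hD : 0 ≤ D)
    (H : ℕ → ℝ) (hH0 : ∀ l : ℕ, 1 ≤ l → 0 ≤ H l) (hHD : ∀ l : ℕ, 1 ≤ l → H l ≤ D ^ l)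
    (mseq : ℕ → ℝ) (hmseq : ∀ k : ℕ, 1 ≤ k → mseq k = momentFormula y H k) :
    (∑' j : ℕ, (ENNReal.ofReal (mseq (2 * (j + 1))))⁻¹ ^ ((1 : ℝ) / (2 * (j + 1))) = ⊤) ∧
    (∀ ν₁ ν₂ : Measure ℝ, IsProbabilityMeasure ν₁ → IsProbabilityMeasure ν₂ →
      (∀ k : ℕ, 1 ≤ k → Integrable (fun x : ℝ => x ^ k) ν₁ ∧ ∫ x, x ^ k ∂ν₁ = mseq k) →
      (∀ k : ℕ, 1 ≤ k → Integrable (fun x : ℝ => x ^ k) ν₂ ∧ ∫ x, x ^ k ∂ν₂ = mseq k) →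
      ν₁ = ν₂) := by
  obtain ⟨C, hC, hbound⟩ := exists_momentFormula_le hy hD hH0 hHD
  have hm : ∀ k : ℕ, 1 ≤ k → mseq k ≤ C ^ k * (Nat.factorial k : ℝ) := fun k hk =>
    (hmseq k hk).trans_le (hbound k)
  refine ⟨tsum_inv_rpow_eq_top_of_le_pow_mul_factorial hC hm, fun ν₁ ν₂ _ _ h₁ h₂ => ?_⟩
  exact eq_of_moment_eq_of_zero_mem_interior_integrableExpSet
    (zero_mem_interior_integrableExpSet_of_moment_le hC (fun k hk => (h₁ k hk).1)
      fun k hk => (h₁ k hk).2.trans_le (hm k hk))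
    (zero_mem_interior_integrableExpSet_of_moment_le hC (fun k hk => (h₂ k hk).1)
      fun k hk => (h₂ k hk).2.trans_le (hm k hk))
    fun k hk => (h₁ k hk).2.trans (h₂ k hk).2.symm
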